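/- arXiv:1904.00692 — 9 statements merged into one kernel-verified Lean document; each statement's English description precedes it below -/
import Mathlib

section
/- The set of intervals with KT-SLS level 0 is pairwise disjoint: if i ≠ j, L(i) = 0 and L(j) = 0, then I_i ∩ I_j = ∅. -/
/-- The set of intervals with KT-SLS level 0 is pairwise disjoint.
The KT-SLS level `L i` is characterized by its defining recurrence: for a point
`t`, `h_i(t)` is the least natural number not occurring among the levels of the
earlier intervals containing `t` (a `mex`, written as an `sInf`), and `L i` is
the maximum of `h_i(t)` over all points `t ∈ I i` that are endpoints of some
interval `I j` with `j ≤ i`. -/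
theorem slsLevel_zero_independent
    (n : ℕ) (l r : Fin n → ℝ) (hlr : ∀ j, l j ≤ r j)
    (L : Fin n → ℕ)
    (hL : ∀ i : Fin n,
      L i = sSup { h : ℕ | ∃ t : ℝ, t ∈ Set.Icc (l i) (r i) ∧
          (∃ j : Fin n, j ≤ i ∧ (t = l j ∨ t = r j)) ∧
          h = sInf { m : ℕ | ∀ j : Fin n, j < i → t ∈ Set.Icc (l j) (r j) → L j ≠ m } }) :
    ∀ i j : Fin n, i ≠ j → L i = 0 → L j = 0 →
      Set.Icc (l i) (r i) ∩ Set.Icc (l j) (r j) = ∅ := by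
  obtain ⟨M, hM⟩ : ∃ M, ∀ j, L j ≠ M := by
    obtain ⟨M, hM⟩ := Infinite.exists_notMem_finset (Finset.univ.image L)
    exact ⟨M, fun j hj => hM (Finset.mem_image.2 ⟨j, Finset.mem_univ j, hj⟩)⟩
  have disjoint_of_lt : ∀ i j : Fin n, i < j → L i = 0 → L j = 0 →
      Set.Icc (l i) (r i) ∩ Set.Icc (l j) (r j) = ∅ := by
    intro i j hij hi hj
    by_contra hne
    obtain ⟨x, hxi, hxj⟩ := Set.nonempty_iff_ne_empty.2 hne
    -- The larger left endpoint lies in both intervals.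
    obtain ⟨t, hti, htj, hend⟩ : ∃ t, t ∈ Set.Icc (l i) (r i) ∧ t ∈ Set.Icc (l j) (r j) ∧
        ∃ k : Fin n, k ≤ j ∧ (t = l k ∨ t = r k) := by
      rcases le_total (l i) (l j) with h | h
      · exact ⟨l j, ⟨h, hxj.1.trans hxi.2⟩, ⟨le_rfl, hlr j⟩, j, le_rfl, Or.inl rfl⟩
      · exact ⟨l i, ⟨le_rfl, hlr i⟩, ⟨h, hxi.1.trans hxj.2⟩, i, hij.le, Or.inl rfl⟩
    have hle : sInf {m : ℕ | ∀ k : Fin n, k < j → t ∈ Set.Icc (l k) (r k) → L k ≠ m} ≤ L j := by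
      rw [hL j]
      refine le_csSup ⟨M, ?_⟩ ⟨t, htj, hend, rfl⟩
      rintro h ⟨s, -, -, rfl⟩
      exact Nat.sInf_le fun k _ _ => hM k
    have hmem := Nat.sInf_mem (s := {m : ℕ | ∀ k : Fin n, k < j →
      t ∈ Set.Icc (l k) (r k) → L k ≠ m}) ⟨M, fun k _ _ => hM k⟩
    rw [Nat.le_zero.1 (hle.trans_eq hj)] at hmem
    exact hmem i hij hti hi
  intro i j hij hi hj
  rcases lt_or_gt_of_ne hij with h | h
  · exact disjoint_of_lt i j h hi hj
  · rw [Set.inter_comm]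
    exact disjoint_of_lt j i h hj hi
end

section
/- For every index i, the number of indices j ≠ i with L(j) = L(i) and I_j ∩ I_i ≠ ∅ is at most 2. That is, within each KT-SLS level, every interval intersects at most two other intervals of the same level. -/
/-- If every interval of a finite family contains a point lying in no other interval of the
family, then each interval meets at most two others. -/
theorem ncard_inter_Icc_le_two_of_private_points {ι : Type*} [Finite ι] (l r p : ι → ℝ)
    (S : Set ι) (hp : ∀ j ∈ S, p j ∈ Set.Icc (l j) (r j))
    (hpriv : ∀ j ∈ S, ∀ k ∈ S, j ≠ k → p j ∉ Set.Icc (l k) (r k)) (i : ι) (hi : i ∈ S) :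
    Set.ncard { j : ι | j ≠ i ∧ j ∈ S ∧
      (Set.Icc (l j) (r j) ∩ Set.Icc (l i) (r i)).Nonempty } ≤ 2 := by
  classical
  have hinj : Set.InjOn (fun j => decide (p j < l i)) { j : ι | j ≠ i ∧ j ∈ S ∧
      (Set.Icc (l j) (r j) ∩ Set.Icc (l i) (r i)).Nonempty } := by
    rintro j ⟨hji, hj, x, ⟨hx1, hx2⟩, hx3, hx4⟩ k ⟨hki, hk, y, ⟨hy1, hy2⟩, hy3, hy4⟩ hjk
    by_contra hne
    obtain ⟨hj1, hj2⟩ := hp j hj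
    obtain ⟨hk1, hk2⟩ := hp k hk
    have hA := hpriv j hj k hk hne
    have hB := hpriv k hk j hj (Ne.symm hne)
    have hC := hpriv j hj i hi hji
    have hD := hpriv k hk i hi hki
    simp only [Set.mem_Icc, not_and, not_le] at hA hB hC hD
    have hiff : p j < l i ↔ p k < l i := by simpa using hjk
    by_cases hlt : p j < l i
    · have hlt' := hiff.1 hlt
      rcases le_total (p j) (p k) with h | h
      · linarith [hB (hj1.trans h)]
      · linarith [hA (hk1.trans h)]
    · have hj3 := hC (not_lt.1 hlt)
      have hk3 := hD (not_lt.1 fun h => hlt (hiff.2 h))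
      rcases le_total (p j) (p k) with h | h
      · linarith [hA (by linarith)]
      · linarith [hB (by linarith)]
  calc _ ≤ (Set.univ : Set Bool).ncard :=
        Set.ncard_le_ncard_of_injOn _ (fun _ _ => Set.mem_univ _) hinj
    _ = 2 := by simp

/-- The levels that do not occur among the intervals before `i` containing `t`. -/
def freeLevels {n : ℕ} (l r : Fin n → ℝ) (L : Fin n → ℕ) (i : Fin n) (t : ℝ) : Set ℕ :=
  { m : ℕ | ∀ j : Fin n, j < i → t ∈ Set.Icc (l j) (r j) → L j ≠ m }

theorem exists_forall_mem_freeLevels {n : ℕ} (l r : Fin n → ℝ) (L : Fin n → ℕ) :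
    ∃ M, ∀ i t, M ∈ freeLevels l r L i t := by
  refine ⟨Finset.univ.sup L + 1, fun i t j _ _ h => ?_⟩
  have := Finset.le_sup (f := L) (Finset.mem_univ j)
  omega

/-- Moving `t` left to the nearest left endpoint of an interval containing it keeps it in all
those intervals. -/
theorem exists_left_endpoint_freeLevels_subset {n : ℕ} (l r : Fin n → ℝ) (L : Fin n → ℕ)
    (i : Fin n) {t : ℝ} (ht : t ∈ Set.Icc (l i) (r i)) :
    ∃ k ≤ i, l k ∈ Set.Icc (l i) (r i) ∧ freeLevels l r L i (l k) ⊆ freeLevels l r L i t := by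
  classical
  obtain ⟨k, hk, hmax⟩ := Finset.exists_max_image
    (Finset.univ.filter fun j => j ≤ i ∧ t ∈ Set.Icc (l j) (r j)) l ⟨i, by simpa using ht⟩
  simp only [Finset.mem_filter, Finset.mem_univ, true_and] at hk hmax
  refine ⟨k, hk.1, ⟨hmax i ⟨le_rfl, ht⟩, hk.2.1.trans ht.2⟩, fun m hm j hj htj => ?_⟩
  exact hm j hj ⟨hmax j ⟨hj.le, htj⟩, hk.2.1.trans htj.2⟩


/-- Within each KT-SLS level, every interval intersects at most two
other intervals of the same level: for every index `i`, the number of indices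
`j ≠ i` with `L j = L i` and `I j ∩ I i ≠ ∅` is at most `2`. The KT-SLS level
`L i` is characterized by its defining recurrence (`mex` over earlier intervals
containing a point, maximized over endpoints contained in `I i`). -/
theorem slsLevel_same_level_degree_le_two
    (n : ℕ) (l r : Fin n → ℝ) (hlr : ∀ j, l j ≤ r j)
    (L : Fin n → ℕ)
    (hL : ∀ i : Fin n,
      L i = sSup { h : ℕ | ∃ t : ℝ, t ∈ Set.Icc (l i) (r i) ∧
          (∃ j : Fin n, j ≤ i ∧ (t = l j ∨ t = r j)) ∧
          h = sInf { m : ℕ | ∀ j : Fin n, j < i → t ∈ Set.Icc (l j) (r j) → L j ≠ m } }) :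
    ∀ i : Fin n,
      Set.ncard { j : Fin n | j ≠ i ∧ L j = L i ∧
        (Set.Icc (l j) (r j) ∩ Set.Icc (l i) (r i)).Nonempty } ≤ 2 := by
  obtain ⟨M, hM⟩ := exists_forall_mem_freeLevels l r L
  have hbdd : ∀ i : Fin n, BddAbove { h : ℕ | ∃ t : ℝ, t ∈ Set.Icc (l i) (r i) ∧
      (∃ j : Fin n, j ≤ i ∧ (t = l j ∨ t = r j)) ∧ h = sInf (freeLevels l r L i t) } := by
    intro i
    refine ⟨M, ?_⟩
    rintro _ ⟨t, -, -, rfl⟩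
    exact Nat.sInf_le (hM i t)
  have hle : ∀ i t, t ∈ Set.Icc (l i) (r i) → sInf (freeLevels l r L i t) ≤ L i := by
    intro i t ht
    obtain ⟨k, hk, hki, hsub⟩ := exists_left_endpoint_freeLevels_subset l r L i ht
    refine (Nat.sInf_le (hsub (Nat.sInf_mem ⟨M, hM i (l k)⟩))).trans ?_
    rw [hL i]
    exact le_csSup (hbdd i) ⟨l k, hki, ⟨k, hk, Or.inl rfl⟩, rfl⟩
  have hatt : ∀ i, ∃ t ∈ Set.Icc (l i) (r i), L i = sInf (freeLevels l r L i t) := by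
    intro i
    have hne : { h : ℕ | ∃ t : ℝ, t ∈ Set.Icc (l i) (r i) ∧
        (∃ j : Fin n, j ≤ i ∧ (t = l j ∨ t = r j)) ∧
        h = sInf (freeLevels l r L i t) }.Nonempty :=
      ⟨_, l i, ⟨le_rfl, hlr i⟩, ⟨i, le_rfl, Or.inl rfl⟩, rfl⟩
    obtain ⟨t, ht, -, h⟩ := Nat.sSup_mem hne (hbdd i)
    exact ⟨t, ht, (hL i).trans h⟩
  choose p hp hpL using hatt
  intro i
  refine ncard_inter_Icc_le_two_of_private_points l r p { j | L j = L i }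
    (fun j _ => hp j) (fun j hj k hk hne hmem => ?_) i rfl
  have hjk : L k = L j := Eq.trans hk (Eq.symm hj)
  rcases lt_or_gt_of_ne hne with h | h
  · have hm := Nat.sInf_mem ⟨M, hM k (p j)⟩
    have h1 := hle k (p j) hmem
    have h2 := hm j h (hp j)
    have h3 : sInf (freeLevels l r L j (p j)) ≤ sInf (freeLevels l r L k (p j)) :=
      Nat.sInf_le fun a ha hta => hm a (ha.trans h) hta
    have h4 := hpL j
    omega
  · exact Nat.sInf_mem ⟨M, hM j (p j)⟩ k h hmem (hjk.trans (hpL j))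
end

section
/- For every index i, L(i) + 1 is at most the maximum, over real points t, of the number of indices j ≤ i with t ∈ I_j. In particular L(i) ≤ ω − 1, where ω is the clique number of the interval graph on I_1,...,I_n. -/
theorem sInf_forall_ne_le_ncard {α : Type*} {s : Set α} (hs : s.Finite) (f : α → ℕ) :
    sInf {m : ℕ | ∀ a ∈ s, f a ≠ m} ≤ s.ncard := by
  set M := sInf {m : ℕ | ∀ a ∈ s, f a ≠ m} with hM
  have hsub : Set.Iio M ⊆ f '' s := by
    intro m hm
    have hm' := Nat.notMem_of_lt_sInf (Set.mem_Iio.mp hm)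
    simpa using hm'
  calc M = (Set.Iio M).ncard := by simp [Set.ncard_eq_toFinset_card']
    _ ≤ (f '' s).ncard := Set.ncard_le_ncard hsub (hs.image f)
    _ ≤ s.ncard := Set.ncard_image_le hs

theorem ncard_le_sSup_ncard {α ι : Type*} [Finite α] (s : ι → Set α) (t : ι) :
    (s t).ncard ≤ sSup {k : ℕ | ∃ t, k = (s t).ncard} := by
  refine le_csSup ⟨Nat.card α, ?_⟩ ⟨t, rfl⟩
  rintro _ ⟨u, rfl⟩
  exact Set.ncard_le_card (s u)


/-- For every index `i`, `L i + 1` is at most the maximum, over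
real points `t`, of the number of indices `j ≤ i` with `t ∈ I j`; in particular
`L i ≤ ω - 1` where the clique number `ω` of the interval graph equals the
maximum, over real points `t`, of the number of indices `j` with `t ∈ I j`.
The KT-SLS level `L i` is characterized by its defining recurrence. -/
theorem slsLevel_le_cliqueNumber_sub_one
    (n : ℕ) (l r : Fin n → ℝ) (hlr : ∀ j, l j ≤ r j)
    (L : Fin n → ℕ)
    (hL : ∀ i : Fin n,
      L i = sSup { h : ℕ | ∃ t : ℝ, t ∈ Set.Icc (l i) (r i) ∧
          (∃ j : Fin n, j ≤ i ∧ (t = l j ∨ t = r j)) ∧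
          h = sInf { m : ℕ | ∀ j : Fin n, j < i → t ∈ Set.Icc (l j) (r j) → L j ≠ m } })
    (ω : ℕ)
    (hω : ω = sSup { k : ℕ | ∃ t : ℝ,
        k = Set.ncard { j : Fin n | t ∈ Set.Icc (l j) (r j) } }) :
    ∀ i : Fin n,
      L i + 1 ≤ sSup { k : ℕ | ∃ t : ℝ,
          k = Set.ncard { j : Fin n | j ≤ i ∧ t ∈ Set.Icc (l j) (r j) } } ∧
      L i ≤ ω - 1 := by
  intro i
  have key : ∀ t ∈ Set.Icc (l i) (r i),
      sInf {m : ℕ | ∀ j : Fin n, j < i → t ∈ Set.Icc (l j) (r j) → L j ≠ m} + 1 ≤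
        Set.ncard {j : Fin n | j ≤ i ∧ t ∈ Set.Icc (l j) (r j)} := by
    intro t ht
    have h := sInf_forall_ne_le_ncard
      (Set.toFinite {j : Fin n | j < i ∧ t ∈ Set.Icc (l j) (r j)}) L
    simp only [Set.mem_ofPred_eq, and_imp] at h
    have hssub : {j : Fin n | j < i ∧ t ∈ Set.Icc (l j) (r j)} ⊂
        {j : Fin n | j ≤ i ∧ t ∈ Set.Icc (l j) (r j)} :=
      Set.ssubset_iff_exists.2
        ⟨fun j hj => ⟨hj.1.le, hj.2⟩, i, ⟨le_rfl, ht⟩, fun hi => lt_irrefl i hi.1⟩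
    exact (Nat.add_le_add_right h 1).trans (Set.ncard_lt_ncard hssub (Set.toFinite _))
  obtain ⟨t, ht, -, hLt⟩ := hL i ▸ Nat.sSup_mem
    (s := {h : ℕ | ∃ t : ℝ, t ∈ Set.Icc (l i) (r i) ∧
      (∃ j : Fin n, j ≤ i ∧ (t = l j ∨ t = r j)) ∧
      h = sInf {m : ℕ | ∀ j : Fin n, j < i → t ∈ Set.Icc (l j) (r j) → L j ≠ m}})
    ⟨_, l i, Set.left_mem_Icc.2 (hlr i), ⟨i, le_rfl, Or.inl rfl⟩, rfl⟩
    ⟨Nat.card (Fin n), by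
      rintro _ ⟨t, ht, -, rfl⟩
      exact (Nat.le_succ _).trans ((key t ht).trans (Set.ncard_le_card _))⟩
  have hcard := key t ht
  rw [← hLt] at hcard
  refine ⟨hcard.trans (ncard_le_sSup_ncard
    (fun t : ℝ => {j : Fin n | j ≤ i ∧ t ∈ Set.Icc (l j) (r j)}) t), ?_⟩
  have hmono : Set.ncard {j : Fin n | j ≤ i ∧ t ∈ Set.Icc (l j) (r j)} ≤
      Set.ncard {j : Fin n | t ∈ Set.Icc (l j) (r j)} :=
    Set.ncard_le_ncard (fun j hj => hj.2) (Set.toFinite _)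
  have hsup := ncard_le_sSup_ncard (fun t : ℝ => {j : Fin n | t ∈ Set.Icc (l j) (r j)}) t
  rw [← hω] at hsup
  exact Nat.le_sub_one_of_lt (hcard.trans (hmono.trans hsup))
end

section
/- For every index i, the Kierstead–Trotter level satisfies p(i) ≤ ω − 1, where ω is the clique number of the interval graph on I_1,...,I_n. -/
/-- For every index `i`, the Kierstead–Trotter level satisfies
`p i ≤ ω - 1`, where the clique number `ω` of the interval graph equals the
maximum, over real points `t`, of the number of indices `j` with `t ∈ I j`.
The Kierstead–Trotter level `p i` is the least `c : ℕ` such that the clique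
number of the interval graph induced on the earlier neighbors of `I i` with
level at most `c` is at most `c`. -/
theorem ktLevel_le_cliqueNumber_sub_one
    (n : ℕ) (l r : Fin n → ℝ) (hlr : ∀ j, l j ≤ r j)
    (p : Fin n → ℕ)
    (hp : ∀ i : Fin n,
      p i = sInf { c : ℕ | ∀ t : ℝ,
        Set.ncard { j : Fin n | j < i ∧
          (Set.Icc (l j) (r j) ∩ Set.Icc (l i) (r i)).Nonempty ∧
          p j ≤ c ∧ t ∈ Set.Icc (l j) (r j) } ≤ c })
    (ω : ℕ)
    (hω : ω = sSup { k : ℕ | ∃ t : ℝ,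
        k = Set.ncard { j : Fin n | t ∈ Set.Icc (l j) (r j) } }) :
    ∀ i : Fin n, p i ≤ ω - 1 := by
  intro i
  by_contra! hlt
  rw [hp i] at hlt
  have hmem := Nat.notMem_of_lt_sInf hlt
  simp only [Set.mem_ofPred_eq, not_forall, not_le] at hmem
  obtain ⟨t, ht⟩ := hmem
  set A := { j : Fin n | j < i ∧
    (Set.Icc (l j) (r j) ∩ Set.Icc (l i) (r i)).Nonempty ∧
    p j ≤ ω - 1 ∧ t ∈ Set.Icc (l j) (r j) }
  have hiA : i ∉ A := fun h => lt_irrefl i h.1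
  -- Project `t` onto `I i`: every interval of `A` still contains the projection.
  have hsub : insert i A ⊆
      { j : Fin n | max (l i) (min t (r i)) ∈ Set.Icc (l j) (r j) } := by
    rintro j (rfl | ⟨-, ⟨s, hsj, hsi⟩, -, htj⟩)
    · exact ⟨le_max_left _ _, max_le (hlr _) (min_le_right _ _)⟩
    · exact ⟨le_max_of_le_right (le_min htj.1 (hsj.1.trans hsi.2)),
        max_le (hsi.1.trans hsj.2) ((min_le_left _ _).trans htj.2)⟩
  have hcard := Set.ncard_le_ncard hsub (Set.toFinite _)
  rw [Set.ncard_insert_of_notMem hiA (Set.toFinite _)] at hcard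
  have hbdd : BddAbove { k : ℕ | ∃ t : ℝ,
      k = Set.ncard { j : Fin n | t ∈ Set.Icc (l j) (r j) } } := by
    refine ⟨Nat.card (Fin n), ?_⟩
    rintro _ ⟨t, rfl⟩
    exact Set.ncard_le_card _
  have hle := le_csSup hbdd ⟨max (l i) (min t (r i)), rfl⟩
  rw [← hω] at hle
  omega
end

section
/- The Kierstead–Trotter levels satisfy Property P: the set { i : p(i) = 0 } is an independent set of the interval graph (its intervals are pairwise disjoint), and for each l ≥ 1 every index i with p(i) = l has at most two indices j ≠ i with p(j) = l and I_j ∩ I_i ≠ ∅. -/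
open Set

/-- The earlier neighbours of `i` with level at most `c` whose intervals contain `t`. -/
def earlierNeighborsAt {n : ℕ} (l r : Fin n → ℝ) (p : Fin n → ℕ) (i : Fin n) (c : ℕ) (t : ℝ) :
    Set (Fin n) :=
  { j : Fin n | j < i ∧ (Set.Icc (l j) (r j) ∩ Set.Icc (l i) (r i)).Nonempty ∧
      p j ≤ c ∧ t ∈ Set.Icc (l j) (r j) }

/-- `p` assigns to every interval its Kierstead–Trotter level. -/
def IsKTLevel {n : ℕ} (l r : Fin n → ℝ) (p : Fin n → ℕ) : Prop :=
  ∀ i : Fin n, p i = sInf { c : ℕ | ∀ t : ℝ, (earlierNeighborsAt l r p i c t).ncard ≤ c }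

namespace IsKTLevel

variable {n : ℕ} {l r : Fin n → ℝ} {p : Fin n → ℕ}

theorem ncard_le (hp : IsKTLevel l r p) (i : Fin n) (t : ℝ) :
    (earlierNeighborsAt l r p i (p i) t).ncard ≤ p i := by
  have hne : { c : ℕ | ∀ t : ℝ, (earlierNeighborsAt l r p i c t).ncard ≤ c }.Nonempty :=
    ⟨n, fun t => by simpa using Set.ncard_le_card (earlierNeighborsAt l r p i n t)⟩
  have h := Nat.sInf_mem hne
  rw [← hp i] at h
  exact h t

theorem exists_lt_ncard (hp : IsKTLevel l r p) {i : Fin n} {c : ℕ} (hc : c < p i) :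
    ∃ t : ℝ, c < (earlierNeighborsAt l r p i c t).ncard := by
  rw [hp i] at hc
  simpa using Nat.notMem_of_lt_sInf hc

/-- Clamping the witness into `I i` only enlarges the family of intervals through it. -/
theorem exists_mem_Icc_lt_ncard (hp : IsKTLevel l r p) (hlr : ∀ j, l j ≤ r j) {i : Fin n}
    {c : ℕ} (hc : c < p i) :
    ∃ t ∈ Icc (l i) (r i), c < (earlierNeighborsAt l r p i c t).ncard := by
  obtain ⟨t, ht⟩ := hp.exists_lt_ncard hc
  refine ⟨max (l i) (min t (r i)), ⟨le_max_left _ _, max_le (hlr i) (min_le_right _ _)⟩,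
    ht.trans_le (Set.ncard_le_ncard ?_ (Set.toFinite _))⟩
  rintro j ⟨hj, ⟨x, ⟨hx₁, hx₂⟩, hx₃, hx₄⟩, hpj, ht₁, ht₂⟩
  refine ⟨hj, ⟨x, ⟨hx₁, hx₂⟩, hx₃, hx₄⟩, hpj, ?_, ?_⟩
  · exact le_max_of_le_right (le_min ht₁ (hx₁.trans hx₄))
  · exact max_le (hx₃.trans hx₂) ((min_le_left _ _).trans ht₂)

/-- Every interval of positive level has a point lying in no other interval of that level. -/
theorem exists_private_point (hp : IsKTLevel l r p) (hlr : ∀ j, l j ≤ r j) {i : Fin n}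
    (hi : 1 ≤ p i) :
    ∃ t ∈ Icc (l i) (r i), ∀ j, j ≠ i → p j = p i → t ∉ Icc (l j) (r j) := by
  obtain ⟨t, hti, ht⟩ := hp.exists_mem_Icc_lt_ncard hlr (i := i) (c := p i - 1) (by omega)
  refine ⟨t, hti, fun j hji hpj htj => ?_⟩
  have key : ∀ a b : Fin n, a < b → i ≤ b → p a = p i → p b = p i → t ∈ Icc (l a) (r a) →
      t ∈ Icc (l b) (r b) → False := by
    intro a b hab hib ha hb hta htb
    have hsub : insert a (earlierNeighborsAt l r p i (p i - 1) t) ⊆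
        earlierNeighborsAt l r p b (p b) t := by
      rintro x (rfl | ⟨hx, -, hpx, htx⟩)
      · exact ⟨hab, ⟨t, hta, htb⟩, by omega, hta⟩
      · exact ⟨hx.trans_le hib, ⟨t, htx, htb⟩, by omega, htx⟩
    have hnot : a ∉ earlierNeighborsAt l r p i (p i - 1) t := by
      rintro ⟨-, -, h, -⟩
      omega
    have h₁ := Set.ncard_le_ncard hsub (Set.toFinite _)
    rw [Set.ncard_insert_of_notMem hnot (Set.toFinite _)] at h₁
    have h₂ := hp.ncard_le b t
    omega
  rcases lt_or_gt_of_ne hji with h | h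
  · exact key j i h le_rfl hpj rfl htj hti
  · exact key i j h h.le rfl hpj hti htj

theorem disjoint_of_level_zero (hp : IsKTLevel l r p) {i j : Fin n} (hji : j < i)
    (hi : p i = 0) (hj : p j = 0) : Icc (l i) (r i) ∩ Icc (l j) (r j) = ∅ := by
  rw [← Set.not_nonempty_iff_eq_empty]
  rintro ⟨t, hti, htj⟩
  have h : j ∈ earlierNeighborsAt l r p i (p i) t := ⟨hji, ⟨t, htj, hti⟩, by omega, htj⟩
  have h₁ := (Set.ncard_pos (Set.toFinite _)).2 ⟨j, h⟩
  have h₂ := hp.ncard_le i t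
  omega

end IsKTLevel

/-- In a family of intervals with private points, each interval meets at most two others. -/
theorem ncard_neighbors_le_two_of_private_points {n : ℕ} {l r t : Fin n → ℝ} {S : Set (Fin n)}
    (ht : ∀ j ∈ S, t j ∈ Icc (l j) (r j))
    (hS : ∀ i ∈ S, ∀ j ∈ S, j ≠ i → t i ∉ Icc (l j) (r j)) {i : Fin n} (hi : i ∈ S) :
    { j | j ≠ i ∧ j ∈ S ∧ (Icc (l j) (r j) ∩ Icc (l i) (r i)).Nonempty }.ncard ≤ 2 := by
  by_contra! hcard
  have side : ∀ j, j ≠ i → j ∈ S → (Icc (l j) (r j) ∩ Icc (l i) (r i)).Nonempty →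
      (l j ≤ r i ∧ r i < t j) ∨ (t j < l i ∧ l i ≤ r j) := by
    rintro j hji hj ⟨x, ⟨hx₁, hx₂⟩, hx₃, hx₄⟩
    have h := hS j hj i hi hji.symm
    rw [mem_Icc, not_and_or, not_le, not_le] at h
    rcases h with h | h
    · exact .inr ⟨h, hx₃.trans hx₂⟩
    · exact .inl ⟨hx₁.trans hx₄, h⟩
  have right : ∀ a ∈ S, ∀ b ∈ S, a ≠ b → l a ≤ r i → r i < t a → l b ≤ r i → r i < t b →
      False := by
    intro a ha b hb hab h₁ h₂ h₃ h₄
    rcases le_total (t a) (t b) with h | h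
    · exact hS a ha b hb hab.symm ⟨by linarith, h.trans (ht b hb).2⟩
    · exact hS b hb a ha hab ⟨by linarith, h.trans (ht a ha).2⟩
  have left : ∀ a ∈ S, ∀ b ∈ S, a ≠ b → t a < l i → l i ≤ r a → t b < l i → l i ≤ r b →
      False := by
    intro a ha b hb hab h₁ h₂ h₃ h₄
    rcases le_total (t a) (t b) with h | h
    · exact hS b hb a ha hab ⟨(ht a ha).1.trans h, by linarith⟩
    · exact hS a ha b hb hab.symm ⟨(ht b hb).1.trans h, by linarith⟩
  obtain ⟨a, ⟨hai, ha, hna⟩, b, ⟨hbi, hb, hnb⟩, c, ⟨hci, hc, hnc⟩, hab, hac, hbc⟩ :=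
    (Set.two_lt_ncard (Set.toFinite _)).1 hcard
  rcases side a hai ha hna with ⟨a₁, a₂⟩ | ⟨a₁, a₂⟩ <;>
  rcases side b hbi hb hnb with ⟨b₁, b₂⟩ | ⟨b₁, b₂⟩ <;>
  rcases side c hci hc hnc with ⟨c₁, c₂⟩ | ⟨c₁, c₂⟩ <;>
  first
  | exact right a ha b hb hab a₁ a₂ b₁ b₂
  | exact right a ha c hc hac a₁ a₂ c₁ c₂
  | exact right b hb c hc hbc b₁ b₂ c₁ c₂
  | exact left a ha b hb hab a₁ a₂ b₁ b₂
  | exact left a ha c hc hac a₁ a₂ c₁ c₂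
  | exact left b hb c hc hbc b₁ b₂ c₁ c₂


/-- The Kierstead–Trotter levels satisfy Property P: the set of
indices with level `0` is an independent set of the interval graph (pairwise
disjoint intervals), and for each `lvl ≥ 1`, every index `i` with `p i = lvl`
has at most two indices `j ≠ i` with `p j = lvl` and `I j ∩ I i ≠ ∅`.
The Kierstead–Trotter level `p i` is the least `c : ℕ` such that the clique
number of the interval graph induced on the earlier neighbors of `I i` with
level at most `c` is at most `c`. -/
theorem ktLevel_property_P
    (n : ℕ) (l r : Fin n → ℝ) (hlr : ∀ j, l j ≤ r j)
    (p : Fin n → ℕ)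
    (hp : ∀ i : Fin n,
      p i = sInf { c : ℕ | ∀ t : ℝ,
        Set.ncard { j : Fin n | j < i ∧
          (Set.Icc (l j) (r j) ∩ Set.Icc (l i) (r i)).Nonempty ∧
          p j ≤ c ∧ t ∈ Set.Icc (l j) (r j) } ≤ c }) :
    (∀ i j : Fin n, i ≠ j → p i = 0 → p j = 0 →
      Set.Icc (l i) (r i) ∩ Set.Icc (l j) (r j) = ∅) ∧
    (∀ lvl : ℕ, 1 ≤ lvl → ∀ i : Fin n, p i = lvl →
      Set.ncard { j : Fin n | j ≠ i ∧ p j = lvl ∧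
        (Set.Icc (l j) (r j) ∩ Set.Icc (l i) (r i)).Nonempty } ≤ 2) := by
  have hkt : IsKTLevel l r p := hp
  refine ⟨fun i j hij hi hj => ?_, ?_⟩
  · rcases lt_or_gt_of_ne hij with h | h
    · rw [Set.inter_comm]
      exact hkt.disjoint_of_level_zero h hj hi
    · exact hkt.disjoint_of_level_zero h hi hj
  · intro lvl hlvl i hi
    have hpt : ∀ i, ∃ t, p i = lvl → t ∈ Set.Icc (l i) (r i) ∧
        ∀ j, j ≠ i → p j = p i → t ∉ Set.Icc (l j) (r j) := by
      intro i
      by_cases h : p i = lvl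
      · obtain ⟨t, ht, ht'⟩ := hkt.exists_private_point hlr (h ▸ hlvl)
        exact ⟨t, fun _ => ⟨ht, ht'⟩⟩
      · exact ⟨0, fun h' => absurd h' h⟩
    choose t ht using hpt
    exact ncard_neighbors_le_two_of_private_points (S := { j | p j = lvl })
      (fun j hj => (ht j hj).1) (fun a ha b hb hba => (ht a ha).2 b hba (hb.trans ha.symm)) hi
end

section
/- There exists a function o : {1,...,n} → {1,2,3} such that the map i ↦ (L(i), o(i)) is a proper coloring of the interval graph on I_1,...,I_n (intersecting intervals receive distinct pairs) and the number of distinct pairs used is at most 3ω − 2, where ω is the clique number of the interval graph. Moreover o can be chosen greedily: o(i) is the least value in {1,2,3} not equal to o(j) for any j < i with L(j) = L(i) and I_j ∩ I_i ≠ ∅. -/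
open Set

/-- If every interval has a point lying in no other interval of the family, then no interval
meets three others. -/
lemma not_three_neighbors_of_private_points {ι : Type*} {l r t : ι → ℝ} {S : Set ι}
    (hmem : ∀ i ∈ S, t i ∈ Icc (l i) (r i))
    (hprivate : ∀ i ∈ S, ∀ j ∈ S, j ≠ i → t i ∉ Icc (l j) (r j))
    {i a b c : ι} (hi : i ∈ S) (ha : a ∈ S) (hb : b ∈ S) (hc : c ∈ S)
    (hai : a ≠ i) (hbi : b ≠ i) (hci : c ≠ i) (hab : a ≠ b) (hac : a ≠ c) (hbc : b ≠ c)
    (ia : (Icc (l a) (r a) ∩ Icc (l i) (r i)).Nonempty)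
    (ib : (Icc (l b) (r b) ∩ Icc (l i) (r i)).Nonempty)
    (ic : (Icc (l c) (r c) ∩ Icc (l i) (r i)).Nonempty) : False := by
  have side : ∀ x ∈ S, x ≠ i → t x < l i ∨ r i < t x := by
    intro x hx hxi
    by_contra! h
    exact hprivate x hx i hi hxi.symm h
  have right : ∀ x ∈ S, ∀ y ∈ S, x ≠ y →
      (Icc (l x) (r x) ∩ Icc (l i) (r i)).Nonempty →
      (Icc (l y) (r y) ∩ Icc (l i) (r i)).Nonempty → r i < t x → r i < t y → False := by
    rintro x hx y hy hxy ⟨p, hpx, hpi⟩ ⟨q, hqy, hqi⟩ h₁ h₂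
    rcases le_total (t x) (t y) with h | h
    · exact hprivate x hx y hy hxy.symm
        ⟨hqy.1.trans (hqi.2.trans h₁.le), h.trans (hmem y hy).2⟩
    · exact hprivate y hy x hx hxy
        ⟨hpx.1.trans (hpi.2.trans h₂.le), h.trans (hmem x hx).2⟩
  have left : ∀ x ∈ S, ∀ y ∈ S, x ≠ y →
      (Icc (l x) (r x) ∩ Icc (l i) (r i)).Nonempty →
      (Icc (l y) (r y) ∩ Icc (l i) (r i)).Nonempty → t x < l i → t y < l i → False := by
    rintro x hx y hy hxy ⟨p, hpx, hpi⟩ ⟨q, hqy, hqi⟩ h₁ h₂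
    rcases le_total (t x) (t y) with h | h
    · exact hprivate y hy x hx hxy
        ⟨(hmem x hx).1.trans h, h₂.le.trans (hpi.1.trans hpx.2)⟩
    · exact hprivate x hx y hy hxy.symm
        ⟨(hmem y hy).1.trans h, h₁.le.trans (hqi.1.trans hqy.2)⟩
  rcases side a ha hai with h₁ | h₁ <;> rcases side b hb hbi with h₂ | h₂ <;>
    rcases side c hc hci with h₃ | h₃
  · exact left a ha b hb hab ia ib h₁ h₂
  · exact left a ha b hb hab ia ib h₁ h₂
  · exact left a ha c hc hac ia ic h₁ h₃
  · exact right b hb c hc hbc ib ic h₂ h₃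
  · exact left b hb c hc hbc ib ic h₂ h₃
  · exact right a ha c hc hac ia ic h₁ h₃
  · exact right a ha b hb hab ia ib h₁ h₂
  · exact right a ha b hb hab ia ib h₁ h₂

/-- Greedy coloring with colors `1, 2, 3` in the order of `Fin n` exists for every conflict
relation; its value is junk where no color is available. -/
lemma exists_greedy_three_coloring {n : ℕ} (R : Fin n → Fin n → Prop) :
    ∃ o : Fin n → ℕ, ∀ i, o i = sInf { c : ℕ | c ∈ ({1, 2, 3} : Set ℕ) ∧
      ∀ j, j < i → R j i → o j ≠ c } := by
  let F : (i : Fin n) → ((j : Fin n) → j < i → ℕ) → ℕ := fun i ih =>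
    sInf { c : ℕ | c ∈ ({1, 2, 3} : Set ℕ) ∧ ∀ j (h : j < i), R j i → ih j h ≠ c }
  exact ⟨wellFounded_lt.fix F, fun i => wellFounded_lt.fix_eq F i⟩

/-- The set of levels avoided by the earlier intervals at a point is nonempty. -/
lemma exists_level_avoiding {n : ℕ} (L : Fin n → ℕ) (P : Fin n → Prop) :
    ∃ m, ∀ j, P j → L j ≠ m := by
  obtain ⟨m, hm⟩ := (Set.finite_range L).exists_notMem
  exact ⟨m, fun j _ h => hm ⟨j, h⟩⟩

section Levels

variable {n : ℕ} {l r : Fin n → ℝ} {L : Fin n → ℕ}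

lemma bddAbove_endpoint_mex (i : Fin n) : BddAbove { h : ℕ | ∃ t : ℝ, t ∈ Icc (l i) (r i) ∧
    (∃ j : Fin n, j ≤ i ∧ (t = l j ∨ t = r j)) ∧
    h = sInf { m : ℕ | ∀ j : Fin n, j < i → t ∈ Icc (l j) (r j) → L j ≠ m } } := by
  apply Set.Finite.bddAbove
  refine (((Set.finite_range l).union (Set.finite_range r)).image fun t : ℝ =>
    sInf { m : ℕ | ∀ j : Fin n, j < i → t ∈ Icc (l j) (r j) → L j ≠ m }).subset ?_
  rintro h ⟨t, -, ⟨j, -, hj⟩, rfl⟩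
  refine ⟨t, ?_, rfl⟩
  rcases hj with rfl | rfl
  · exact Or.inl ⟨j, rfl⟩
  · exact Or.inr ⟨j, rfl⟩

variable
  (hL : ∀ i : Fin n,
    L i = sSup { h : ℕ | ∃ t : ℝ, t ∈ Icc (l i) (r i) ∧
      (∃ j : Fin n, j ≤ i ∧ (t = l j ∨ t = r j)) ∧
      h = sInf { m : ℕ | ∀ j : Fin n, j < i → t ∈ Icc (l j) (r j) → L j ≠ m } })

include hL

/-- The level of an interval is the mex at one of the admissible endpoints it contains. -/
lemma level_attained (hlr : ∀ j, l j ≤ r j) (i : Fin n) :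
    ∃ t ∈ Icc (l i) (r i), (∃ j ≤ i, t = l j ∨ t = r j) ∧
      (∀ j < i, t ∈ Icc (l j) (r j) → L j ≠ L i) ∧
      ∀ m < L i, ∃ j < i, t ∈ Icc (l j) (r j) ∧ L j = m := by
  have hmem := (bddAbove_endpoint_mex (l := l) (r := r) (L := L) i) |> Nat.sSup_mem
    (by exact ⟨_, l i, ⟨le_rfl, hlr i⟩, ⟨i, le_rfl, Or.inl rfl⟩, rfl⟩)
  rw [← hL i] at hmem
  obtain ⟨t, ht, hj, hmex⟩ := hmem
  refine ⟨t, ht, hj, ?_, ?_⟩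
  · obtain ⟨m, hm⟩ := exists_level_avoiding L fun j => j < i ∧ t ∈ Icc (l j) (r j)
    have := Nat.sInf_mem (s := { m : ℕ | ∀ j : Fin n, j < i → t ∈ Icc (l j) (r j) → L j ≠ m })
      ⟨m, fun j h₁ h₂ => hm j ⟨h₁, h₂⟩⟩
    rwa [← hmex] at this
  · intro m hm
    rw [hmex] at hm
    have := Nat.notMem_of_lt_sInf hm
    simp only [mem_ofPred_eq, not_forall, not_not] at this
    obtain ⟨j, h₁, h₂, h₃⟩ := this
    exact ⟨j, h₁, h₂, h₃⟩

/-- At each admissible endpoint in an interval, some value up to its level is unused by the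
earlier intervals. -/
lemma exists_le_level_avoiding {i k : Fin n} {t : ℝ} (ht : t ∈ Icc (l i) (r i)) (hk : k ≤ i)
    (htk : t = l k ∨ t = r k) :
    ∃ m ≤ L i, ∀ j < i, t ∈ Icc (l j) (r j) → L j ≠ m := by
  obtain ⟨m, hm⟩ := exists_level_avoiding L fun j => j < i ∧ t ∈ Icc (l j) (r j)
  refine ⟨sInf { m : ℕ | ∀ j : Fin n, j < i → t ∈ Icc (l j) (r j) → L j ≠ m }, ?_,
    Nat.sInf_mem (s := { m : ℕ | ∀ j : Fin n, j < i → t ∈ Icc (l j) (r j) → L j ≠ m })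
      ⟨m, fun j h₁ h₂ => hm j ⟨h₁, h₂⟩⟩⟩
  rw [hL i]
  exact le_csSup (bddAbove_endpoint_mex i) ⟨t, ht, ⟨k, hk, htk⟩, rfl⟩

/-- Every interval contains a point that lies in no other interval of the same level. -/
lemma exists_private_point (hlr : ∀ j, l j ≤ r j) (i : Fin n) :
    ∃ t ∈ Icc (l i) (r i), ∀ j ≠ i, L j = L i → t ∉ Icc (l j) (r j) := by
  obtain ⟨t, ht, ⟨k, hk, htk⟩, havoid, hbelow⟩ := level_attained hL hlr i
  refine ⟨t, ht, fun j hji hLj htj => ?_⟩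
  rcases lt_or_gt_of_ne hji with h | h
  · exact havoid j h htj hLj
  · obtain ⟨m, hm, hm'⟩ := exists_le_level_avoiding hL htj (hk.trans h.le) htk
    rcases (hLj ▸ hm).lt_or_eq with hlt | heq
    · obtain ⟨j', hj', htj', rfl⟩ := hbelow m hlt
      exact hm' j' (hj'.trans h) htj' rfl
    · exact hm' i h ht heq.symm

/-- The intervals of level `0` are pairwise disjoint. -/
lemma level_ne_zero_of_inter {i j : Fin n} (hji : j < i) (hLj : L j = 0)
    (hne : (Icc (l j) (r j) ∩ Icc (l i) (r i)).Nonempty) : L i ≠ 0 := by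
  intro hLi
  obtain ⟨p, hpj, hpi⟩ := hne
  obtain ⟨k, hk, t, htk, htj, hti⟩ : ∃ k ≤ i, ∃ t, (t = l k ∨ t = r k) ∧
      t ∈ Icc (l j) (r j) ∧ t ∈ Icc (l i) (r i) := by
    rcases le_total (l j) (l i) with h | h
    · exact ⟨i, le_rfl, l i, Or.inl rfl, ⟨h, hpi.1.trans hpj.2⟩, le_rfl, hpi.1.trans hpi.2⟩
    · exact ⟨j, hji.le, l j, Or.inl rfl, ⟨le_rfl, hpj.1.trans hpj.2⟩, h, hpj.1.trans hpi.2⟩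
  obtain ⟨m, hm, hm'⟩ := exists_le_level_avoiding hL hti hk htk
  exact hm' j hji htj (by omega)

/-- Every level is smaller than the number of intervals through some point. -/
lemma exists_level_lt_ncard (hlr : ∀ j, l j ≤ r j) (i : Fin n) :
    ∃ t : ℝ, L i < Set.ncard { j : Fin n | t ∈ Icc (l j) (r j) } := by
  obtain ⟨t, ht, -, -, hbelow⟩ := level_attained hL hlr i
  refine ⟨t, ?_⟩
  have hsub : ((Finset.range (L i + 1) : Finset ℕ) : Set ℕ) ⊆
      L '' { j : Fin n | t ∈ Icc (l j) (r j) } := by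
    intro m hm
    rcases (Nat.lt_succ_iff.1 (by simpa using hm)).lt_or_eq with h | rfl
    · obtain ⟨j, -, hj, rfl⟩ := hbelow m h
      exact ⟨j, hj, rfl⟩
    · exact ⟨i, ht, rfl⟩
  have h₁ := Set.ncard_le_ncard hsub (Set.toFinite _)
  have h₂ := Set.ncard_image_le (f := L) (Set.toFinite { j : Fin n | t ∈ Icc (l j) (r j) })
  rw [Set.ncard_coe_finset, Finset.card_range] at h₁
  omega

end Levels


/-- There exists an offset function `o : {1,...,n} → {1,2,3}` such
that `i ↦ (L i, o i)` is a proper coloring of the interval graph (intersecting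
intervals receive distinct pairs) using at most `3ω - 2` distinct pairs, where
`ω` is the clique number of the interval graph (the maximum, over points `t`,
of the number of intervals containing `t`). Moreover `o` can be chosen
greedily: `o i` is the least value in `{1,2,3}` not equal to `o j` for any
`j < i` with `L j = L i` and `I j ∩ I i ≠ ∅`. The KT-SLS level `L i` is
characterized by its defining recurrence. -/
theorem sls_coloring_uses_at_most_three_omega_sub_two
    (n : ℕ) (hn : 1 ≤ n) (l r : Fin n → ℝ) (hlr : ∀ j, l j ≤ r j)
    (L : Fin n → ℕ)
    (hL : ∀ i : Fin n,
      L i = sSup { h : ℕ | ∃ t : ℝ, t ∈ Set.Icc (l i) (r i) ∧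
          (∃ j : Fin n, j ≤ i ∧ (t = l j ∨ t = r j)) ∧
          h = sInf { m : ℕ | ∀ j : Fin n, j < i → t ∈ Set.Icc (l j) (r j) → L j ≠ m } })
    (ω : ℕ)
    (hω : ω = sSup { k : ℕ | ∃ t : ℝ,
        k = Set.ncard { j : Fin n | t ∈ Set.Icc (l j) (r j) } }) :
    ∃ o : Fin n → ℕ,
      (∀ i : Fin n, o i = sInf { c : ℕ | c ∈ ({1, 2, 3} : Set ℕ) ∧
          ∀ j : Fin n, j < i → L j = L i →
            (Set.Icc (l j) (r j) ∩ Set.Icc (l i) (r i)).Nonempty → o j ≠ c }) ∧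
      (∀ i : Fin n, o i ∈ ({1, 2, 3} : Set ℕ)) ∧
      (∀ i j : Fin n, i ≠ j →
        (Set.Icc (l i) (r i) ∩ Set.Icc (l j) (r j)).Nonempty →
        (L i, o i) ≠ (L j, o j)) ∧
      Set.ncard (Set.range fun i : Fin n => (L i, o i)) ≤ 3 * ω - 2 := by
  have hω_lt : ∀ i, L i < ω := by
    intro i
    obtain ⟨t, ht⟩ := exists_level_lt_ncard hL hlr i
    refine ht.trans_le ?_
    rw [hω]
    refine le_csSup ⟨n, ?_⟩ ⟨t, rfl⟩
    rintro k ⟨s, rfl⟩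
    simpa using Set.ncard_le_card { j : Fin n | s ∈ Set.Icc (l j) (r j) }
  choose t ht_mem ht_private using exists_private_point hL hlr
  obtain ⟨o, ho⟩ := exists_greedy_three_coloring fun j i : Fin n =>
    L j = L i ∧ (Set.Icc (l j) (r j) ∩ Set.Icc (l i) (r i)).Nonempty
  simp only [and_imp] at ho
  have hspec : ∀ i, o i ∈ { c : ℕ | c ∈ ({1, 2, 3} : Set ℕ) ∧
      ∀ j : Fin n, j < i → L j = L i →
        (Set.Icc (l j) (r j) ∩ Set.Icc (l i) (r i)).Nonempty → o j ≠ c } := by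
    intro i
    rw [ho i]
    refine Nat.sInf_mem ?_
    by_contra hempty
    have hused : ∀ c ∈ ({1, 2, 3} : Set ℕ), ∃ j < i, L j = L i ∧
        (Set.Icc (l j) (r j) ∩ Set.Icc (l i) (r i)).Nonempty ∧ o j = c := by
      intro c hc
      by_contra! h
      exact hempty ⟨c, hc, h⟩
    obtain ⟨a, ha, hLa, ia, hoa⟩ := hused 1 (by simp)
    obtain ⟨b, hb, hLb, ib, hob⟩ := hused 2 (by simp)
    obtain ⟨c, hc, hLc, ic, hoc⟩ := hused 3 (by simp)
    refine not_three_neighbors_of_private_points (S := { j | L j = L i })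
      (fun j _ => ht_mem j)
      (fun j hj k hk hkj => ht_private j k hkj (Eq.trans hk (Eq.symm hj)))
      rfl hLa hLb hLc ha.ne hb.ne hc.ne ?_ ?_ ?_ ia ib ic <;> rintro rfl <;> omega
  have hzero : ∀ i, L i = 0 → o i = 1 := by
    intro i hi
    have hle : o i ≤ 1 := by
      rw [ho i]
      refine Nat.sInf_le ⟨by simp, fun j hj hLj hne => ?_⟩
      exact absurd hi (level_ne_zero_of_inter hL hj (hLj.trans hi) hne)
    have := (hspec i).1
    simp only [Set.mem_insert_iff, Set.mem_singleton_iff] at this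
    omega
  refine ⟨o, ho, fun i => (hspec i).1, ?_, ?_⟩
  · intro i j hij hne heq
    obtain ⟨hLij, hoij⟩ := Prod.mk.inj heq
    rcases lt_or_gt_of_ne hij with h | h
    · exact (hspec j).2 i h hLij hne hoij
    · exact (hspec i).2 j h hLij.symm (Set.inter_comm _ _ ▸ hne) hoij.symm
  · have hsub : (Set.range fun i : Fin n => (L i, o i)) ⊆
        ((insert (0, 1) (Finset.Ico 1 ω ×ˢ {1, 2, 3}) : Finset (ℕ × ℕ)) : Set (ℕ × ℕ)) := by
      rintro _ ⟨i, rfl⟩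
      rcases Nat.eq_zero_or_pos (L i) with h | h
      · simp [h, hzero i h]
      · have hoi : o i = 1 ∨ o i = 2 ∨ o i = 3 := by simpa using (hspec i).1
        have hLi : 1 ≤ L i ∧ L i < ω := ⟨h, hω_lt i⟩
        simp [hoi, hLi]
    have hcard := Set.ncard_le_ncard hsub (Finset.finite_toSet _)
    rw [Set.ncard_coe_finset] at hcard
    have hins := Finset.card_insert_le ((0, 1) : ℕ × ℕ) (Finset.Ico 1 ω ×ˢ {1, 2, 3})
    rw [Finset.card_product, Nat.card_Ico,
      show ({1, 2, 3} : Finset ℕ).card = 3 from rfl] at hins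
    have hpos := hω_lt ⟨0, hn⟩
    omega
end

section
/- Let I_1,...,I_n be a finite sequence of nonempty closed real intervals and let L : {1,...,n} → ℕ satisfy invariant C: for every i there exists a point t ∈ I_i such that for every r < L(i) there is an index j ≠ i with t ∈ I_j and L(j) = r. Then for every i, L(i) ≤ ω − 1, where ω is the clique number of the interval graph on I_1,...,I_n. -/
/-- Let `I_1,...,I_n` be nonempty closed real intervals and let
`L : {1,...,n} → ℕ` satisfy invariant C: for every `i` there exists a point
`t ∈ I i` such that for every `m < L i` there is an index `j ≠ i` with
`t ∈ I j` and `L j = m`. Then for every `i`, `L i ≤ ω - 1`, where the clique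
number `ω` of the interval graph equals the maximum, over real points `t`, of
the number of indices `j` with `t ∈ I j`. -/
theorem invariantC_level_le_cliqueNumber_sub_one
    (n : ℕ) (l r : Fin n → ℝ) (hlr : ∀ j, l j ≤ r j)
    (L : Fin n → ℕ)
    (hC : ∀ i : Fin n, ∃ t ∈ Set.Icc (l i) (r i),
      ∀ m : ℕ, m < L i → ∃ j : Fin n, j ≠ i ∧ t ∈ Set.Icc (l j) (r j) ∧ L j = m)
    (ω : ℕ)
    (hω : ω = sSup { k : ℕ | ∃ t : ℝ,
        k = Set.ncard { j : Fin n | t ∈ Set.Icc (l j) (r j) } }) :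
    ∀ i : Fin n, L i ≤ ω - 1 := by
  intro i
  obtain ⟨t, hti, ht⟩ := hC i
  set S : Set (Fin n) := {j | t ∈ Set.Icc (l j) (r j)} with hS
  have hsub : Set.Iio (L i + 1) ⊆ L '' S := by
    intro m hm
    rcases (Nat.lt_succ_iff.mp hm).lt_or_eq with h | rfl
    · obtain ⟨j, -, hj, rfl⟩ := ht m h
      exact ⟨j, hj, rfl⟩
    · exact ⟨i, hti, rfl⟩
  have hlevels : L i + 1 ≤ S.ncard := calc
    L i + 1 = (Set.Iio (L i + 1)).ncard := by
      rw [← Finset.coe_Iio, Set.ncard_coe_finset, Nat.card_Iio]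
    _ ≤ (L '' S).ncard := Set.ncard_le_ncard hsub (S.toFinite.image L)
    _ ≤ S.ncard := Set.ncard_image_le S.toFinite
  have hbdd : BddAbove {k : ℕ | ∃ t : ℝ,
      k = Set.ncard {j : Fin n | t ∈ Set.Icc (l j) (r j)}} := by
    refine ⟨n, ?_⟩
    rintro _ ⟨u, rfl⟩
    simpa using Set.ncard_le_card {j : Fin n | u ∈ Set.Icc (l j) (r j)}
  have hmax : S.ncard ≤ ω := hω ▸ le_csSup hbdd ⟨t, rfl⟩
  omega
end

section
/- The KT-SLS level can be strictly smaller than the Kierstead–Trotter level: for the sequence of intervals I_1 = [1,2], I_2 = [8,9], I_3 = [1,7], I_4 = [3,9], I_5 = [4,6], I_6 = [4,6] (presented in this order), one has L(6) = 2 while p(6) = 3; in particular there exists a finite sequence of nonempty closed real intervals and an index i with L(i) < p(i). -/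
/-- To compute a KT-SLS level as `v`, it suffices to bound the free level at every point of the
interval by `v` and to exhibit an endpoint at which all levels below `v` are taken. -/
theorem slsLevel_eq_of_le_of_forall_lt {n : ℕ} {l r : Fin n → ℝ} {L : Fin n → ℕ} {i : Fin n}
    (hL : L i = sSup { h : ℕ | ∃ t : ℝ, t ∈ Set.Icc (l i) (r i) ∧
      (∃ j : Fin n, j ≤ i ∧ (t = l j ∨ t = r j)) ∧
      h = sInf { m : ℕ | ∀ j : Fin n, j < i → t ∈ Set.Icc (l j) (r j) → L j ≠ m } })
    {v : ℕ}
    (hle : ∀ t ∈ Set.Icc (l i) (r i),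
      ∃ m ≤ v, ∀ j < i, t ∈ Set.Icc (l j) (r j) → L j ≠ m)
    (t : ℝ) (ht : t ∈ Set.Icc (l i) (r i)) (hend : ∃ j ≤ i, t = l j ∨ t = r j)
    (hlt : ∀ m < v, ∃ j < i, t ∈ Set.Icc (l j) (r j) ∧ L j = m) :
    L i = v := by
  rw [hL]
  refine IsGreatest.csSup_eq ⟨⟨t, ht, hend, ?_⟩, ?_⟩
  · obtain ⟨m, hm, hfree⟩ := hle t ht
    refine le_antisymm (le_csInf ⟨m, hfree⟩ fun k hk => ?_) (le_trans (Nat.sInf_le hfree) hm)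
    by_contra! hkv
    obtain ⟨j, hj, htj, hjk⟩ := hlt k hkv
    exact hk j hj htj hjk
  · rintro _ ⟨s, hs, -, rfl⟩
    obtain ⟨m, hm, hfree⟩ := hle s hs
    exact le_trans (Nat.sInf_le hfree) hm

/-- To compute a Kierstead–Trotter level as `v`, it suffices to cover the relevant earlier
intervals through any point by at most `v` indices, and to exhibit for each `c < v` a clique of
more than `c` earlier neighbors of level at most `c`. -/
theorem ktLevel_eq_of_le_of_forall_lt {n : ℕ} {l r : Fin n → ℝ} {p : Fin n → ℕ} {i : Fin n}
    (hp : p i = sInf { c : ℕ | ∀ t : ℝ,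
      Set.ncard { j : Fin n | j < i ∧
        (Set.Icc (l j) (r j) ∩ Set.Icc (l i) (r i)).Nonempty ∧
        p j ≤ c ∧ t ∈ Set.Icc (l j) (r j) } ≤ c })
    {v : ℕ}
    (hle : ∀ t : ℝ, ∃ s : Finset (Fin n), s.card ≤ v ∧ ∀ j < i,
      (∃ u, u ∈ Set.Icc (l j) (r j) ∧ u ∈ Set.Icc (l i) (r i)) →
      p j ≤ v → t ∈ Set.Icc (l j) (r j) → j ∈ s)
    (hlt : ∀ c < v, ∃ (s : Finset (Fin n)) (t : ℝ), c < s.card ∧ ∀ j ∈ s, j < i ∧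
      (∃ u, u ∈ Set.Icc (l j) (r j) ∧ u ∈ Set.Icc (l i) (r i)) ∧
      p j ≤ c ∧ t ∈ Set.Icc (l j) (r j)) :
    p i = v := by
  rw [hp]
  refine IsLeast.csInf_eq ⟨fun t => ?_, fun c hc => ?_⟩
  · obtain ⟨s, hs, hsub⟩ := hle t
    refine le_trans ?_ hs
    rw [← Set.ncard_coe_finset s]
    exact Set.ncard_le_ncard (fun j ⟨hj, hne, hpj, htj⟩ => hsub j hj hne hpj htj)
      s.finite_toSet
  · by_contra! hcv
    obtain ⟨s, t, hs, hsub⟩ := hlt c hcv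
    refine absurd (hc t) (not_le.mpr (hs.trans_le ?_))
    rw [← Set.ncard_coe_finset s]
    exact Set.ncard_le_ncard (fun j hj => hsub j hj) (Set.toFinite _)

/-- The KT-SLS level can be strictly smaller than the
Kierstead–Trotter level: for the intervals `I₁ = [1,2]`, `I₂ = [8,9]`,
`I₃ = [1,7]`, `I₄ = [3,9]`, `I₅ = [4,6]`, `I₆ = [4,6]` presented in this order,
one has `L 6 = 2` while `p 6 = 3` (indices `0,...,5` here, so interval `I₆` has
index `5`); in particular there is an index `i` with `L i < p i`. The KT-SLS
level `L` and the Kierstead–Trotter level `p` are characterized by their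
defining recurrences. -/
theorem slsLevel_lt_ktLevel_example
    (l r : Fin 6 → ℝ)
    (hl : l = ![1, 8, 1, 3, 4, 4]) (hr : r = ![2, 9, 7, 9, 6, 6])
    (L : Fin 6 → ℕ)
    (hL : ∀ i : Fin 6,
      L i = sSup { h : ℕ | ∃ t : ℝ, t ∈ Set.Icc (l i) (r i) ∧
          (∃ j : Fin 6, j ≤ i ∧ (t = l j ∨ t = r j)) ∧
          h = sInf { m : ℕ | ∀ j : Fin 6, j < i → t ∈ Set.Icc (l j) (r j) → L j ≠ m } })
    (p : Fin 6 → ℕ)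
    (hp : ∀ i : Fin 6,
      p i = sInf { c : ℕ | ∀ t : ℝ,
        Set.ncard { j : Fin 6 | j < i ∧
          (Set.Icc (l j) (r j) ∩ Set.Icc (l i) (r i)).Nonempty ∧
          p j ≤ c ∧ t ∈ Set.Icc (l j) (r j) } ≤ c }) :
    L 5 = 2 ∧ p 5 = 3 ∧ ∃ i : Fin 6, L i < p i := by
  subst hl hr
  have hL0 : L 0 = 0 := by
    refine slsLevel_eq_of_le_of_forall_lt (hL 0) (fun t _ => ⟨0, le_rfl, ?_⟩) 1 ?_
      ⟨0, le_rfl, ?_⟩ ?_ <;> simp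
  have hL1 : L 1 = 0 := by
    refine slsLevel_eq_of_le_of_forall_lt (hL 1) (fun t ht => ⟨0, le_rfl, ?_⟩) 8 ?_
      ⟨1, le_rfl, ?_⟩ ?_
    · simp at ht ⊢
      intros; linarith
    all_goals simp <;> norm_num
  have hL2 : L 2 = 1 := by
    refine slsLevel_eq_of_le_of_forall_lt (hL 2) (fun t _ => ⟨1, le_rfl, ?_⟩) 1 ?_
      ⟨2, le_rfl, ?_⟩ fun m hm => ⟨0, ?_, ?_, ?_⟩
    · simp [Fin.forall_fin_succ, hL0, hL1]
    · simp
    · simp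
    · decide
    · simp
    · omega
  have hL3 : L 3 = 1 := by
    refine slsLevel_eq_of_le_of_forall_lt (hL 3) (fun t ht => ?_) 8 ?_
      ⟨1, by decide, ?_⟩ fun m hm => ⟨1, ?_, ?_, ?_⟩
    · simp at ht
      rcases lt_or_ge t 8 with h | h
      · refine ⟨0, by simp, ?_⟩
        simp [Fin.forall_fin_succ, hL0, hL1, hL2]
        constructor <;> intros <;> linarith
      · refine ⟨1, by simp, ?_⟩
        simp [Fin.forall_fin_succ, hL0, hL1, hL2]
        intros; linarith
    · simp; norm_num
    · simp
    · decide
    · simp; norm_num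
    · omega
  have hL4 : L 4 = 0 := by
    refine slsLevel_eq_of_le_of_forall_lt (hL 4) (fun t ht => ⟨0, le_rfl, ?_⟩) 4 ?_
      ⟨4, le_rfl, ?_⟩ ?_
    · simp [Fin.forall_fin_succ, hL0, hL1, hL2, hL3] at ht ⊢
      constructor <;> intros <;> linarith
    all_goals simp <;> norm_num
  have hL5 : L 5 = 2 := by
    refine slsLevel_eq_of_le_of_forall_lt (hL 5) (fun t ht => ⟨2, le_rfl, ?_⟩) 4 ?_
      ⟨5, le_rfl, ?_⟩ fun m hm => ?_
    · simp [Fin.forall_fin_succ, hL0, hL1, hL2, hL3, hL4]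
    · simp; norm_num
    · simp
    · interval_cases m
      · exact ⟨4, by decide, (by simp; norm_num), hL4⟩
      · exact ⟨3, by decide, (by simp; norm_num), hL3⟩
  have hp0 : p 0 = 0 := by
    refine ktLevel_eq_of_le_of_forall_lt (hp 0) (fun t => ⟨∅, le_rfl, ?_⟩) ?_ <;> simp
  have hp1 : p 1 = 0 := by
    refine ktLevel_eq_of_le_of_forall_lt (hp 1) (fun t => ⟨∅, le_rfl, ?_⟩) ?_
    · simp
      intros; linarith
    · simp
  have hp2 : p 2 = 1 := by
    refine ktLevel_eq_of_le_of_forall_lt (hp 2) (fun t => ⟨{0}, by simp, ?_⟩)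
      fun c hc => ⟨{0}, 1, by simpa using hc, ?_⟩
    · simp [Fin.forall_fin_succ]
      intros; linarith
    · simp [hp0]
      exact ⟨1, by simp⟩
  have hp3 : p 3 = 1 := by
    refine ktLevel_eq_of_le_of_forall_lt (hp 3) (fun t => ?_)
      fun c hc => ⟨{1}, 8, by simpa using hc, ?_⟩
    · rcases lt_or_ge t 8 with h | h
      · refine ⟨{2}, by simp, ?_⟩
        simp [Fin.forall_fin_succ]
        constructor <;> intros <;> linarith
      · refine ⟨{1}, by simp, ?_⟩
        simp [Fin.forall_fin_succ]
        constructor <;> intros <;> linarith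
    · simp [hp1]
      exact ⟨⟨8, by norm_num⟩, by norm_num⟩
  have hp4 : p 4 = 0 := by
    refine ktLevel_eq_of_le_of_forall_lt (hp 4) (fun t => ⟨∅, le_rfl, ?_⟩) ?_
    · simp [Fin.forall_fin_succ, hp0, hp1, hp2, hp3]
      constructor <;> intros <;> linarith
    · simp
  have hp5 : p 5 = 3 := by
    refine ktLevel_eq_of_le_of_forall_lt (hp 5) (fun t => ⟨{2, 3, 4}, by decide, ?_⟩)
      fun c hc => ?_
    · simp [Fin.forall_fin_succ]
      constructor <;> intros <;> linarith
    · rcases Nat.eq_zero_or_pos c with rfl | hc0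
      · refine ⟨{4}, 4, by simp, ?_⟩
        simp [hp4]
        exact ⟨⟨4, by norm_num⟩, by norm_num⟩
      · refine ⟨{2, 3, 4}, 4, by simpa using hc, ?_⟩
        simp [hp2, hp3, hp4]
        refine ⟨⟨⟨4, ?_⟩, ?_⟩, ⟨⟨4, ?_⟩, ?_⟩, ⟨4, ?_⟩, ?_⟩ <;> norm_num <;> omega
  exact ⟨hL5, hp5, 5, by omega⟩
end

section
/- For every index i and every point t ∈ I_i, the value h_i(t) satisfies: the indices { j : j < i, t ∈ I_j, L(j) < h_i(t) } realize every level 0, 1, ..., h_i(t) − 1 exactly among intervals containing t, and these indices together with i form a set of h_i(t) + 1 intervals all containing the point t (hence a clique of size h_i(t) + 1 in the interval graph on I_1,...,I_i). -/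
/-- For every index `i` and every point `t ∈ I i`, the value
`h = h_i(t)` (the `mex` of the levels of earlier intervals containing `t`)
satisfies: every level `0, 1, ..., h - 1` is realized by some earlier interval
containing `t` (so the indices `{ j | j < i, t ∈ I j, L j < h }` realize every
such level exactly), and these indices together with `i` contain a set `S` of
`h + 1` intervals all containing the point `t` — hence a clique of size `h + 1`
in the interval graph on `I_1, ..., I_i`. The KT-SLS level `L` is characterized
by its defining recurrence. -/
theorem sls_height_gives_clique
    (n : ℕ) (l r : Fin n → ℝ) (hlr : ∀ j, l j ≤ r j)
    (L : Fin n → ℕ)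
    (hL : ∀ i : Fin n,
      L i = sSup { h : ℕ | ∃ t : ℝ, t ∈ Set.Icc (l i) (r i) ∧
          (∃ j : Fin n, j ≤ i ∧ (t = l j ∨ t = r j)) ∧
          h = sInf { m : ℕ | ∀ j : Fin n, j < i → t ∈ Set.Icc (l j) (r j) → L j ≠ m } }) :
    ∀ (i : Fin n) (t : ℝ), t ∈ Set.Icc (l i) (r i) →
      ∀ h : ℕ,
        h = sInf { m : ℕ | ∀ j : Fin n, j < i → t ∈ Set.Icc (l j) (r j) → L j ≠ m } →
        (∀ m : ℕ, m < h → ∃ j : Fin n, j < i ∧ t ∈ Set.Icc (l j) (r j) ∧ L j = m) ∧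
        (∃ S : Finset (Fin n), S.card = h + 1 ∧ i ∈ S ∧
          (∀ j ∈ S, j ≤ i ∧ t ∈ Set.Icc (l j) (r j)) ∧
          (∀ j ∈ S, j ≠ i → j < i ∧ L j < h) ∧
          (∀ j ∈ S, ∀ k ∈ S, j ≠ k →
            (Set.Icc (l j) (r j) ∩ Set.Icc (l k) (r k)).Nonempty)) := by
  intro i t ht h hh
  have realized : ∀ m : ℕ, m < h →
      ∃ j : Fin n, j < i ∧ t ∈ Set.Icc (l j) (r j) ∧ L j = m := by
    intro m hm
    have hm' := Nat.notMem_of_lt_sInf (hh ▸ hm)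
    simp only [Set.mem_ofPred_eq] at hm'
    push Not at hm'
    exact hm'
  refine ⟨realized, ?_⟩
  choose f f_lt f_mem f_level using fun m : Fin h => realized m m.isLt
  have f_inj : Function.Injective f := fun a b hab =>
    Fin.ext (by rw [← f_level a, ← f_level b, hab])
  have i_notMem : i ∉ Finset.univ.image f := by
    simp only [Finset.mem_image, Finset.mem_univ, true_and, not_exists]
    exact fun m => (f_lt m).ne
  have contains : ∀ j ∈ insert i (Finset.univ.image f),
      j ≤ i ∧ t ∈ Set.Icc (l j) (r j) := by
    intro j hj
    simp only [Finset.mem_insert, Finset.mem_image, Finset.mem_univ, true_and] at hj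
    rcases hj with rfl | ⟨m, rfl⟩
    · exact ⟨le_rfl, ht⟩
    · exact ⟨(f_lt m).le, f_mem m⟩
  refine ⟨insert i (Finset.univ.image f), ?_, Finset.mem_insert_self _ _, contains, ?_,
    fun j hj k hk _ => ⟨t, (contains j hj).2, (contains k hk).2⟩⟩
  · rw [Finset.card_insert_of_notMem i_notMem, Finset.card_image_of_injective _ f_inj,
      Finset.card_univ, Fintype.card_fin]
  · intro j hj hji
    obtain ⟨m, -, rfl⟩ := Finset.mem_image.1 (Finset.mem_of_mem_insert_of_ne hj hji)
    exact ⟨f_lt m, (f_level m).trans_lt m.isLt⟩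
end
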